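/- Let A be a strongly commutative DG R-algebra and let M and N be DG A-modules with M bounded below and N semifree. Suppose there is a descending sequence M = M^0 ⊇ M^1 ⊇ M^2 ⊇ ⋯ of DG A-submodules of M such that (1) lim_{ℓ→∞} inf(M^ℓ) = ∞, and (2) for all ℓ ≥ 1 the natural inclusions M^ℓ ↪ M induce isomorphisms Hom_{K(A)}(N, M^ℓ) ≅ Hom_{K(A)}(N, M). Then Hom_{K(A)}(N, M) = 0. -/

import Mathlib

/-!
Common framework: strongly commutative non-negatively graded DG algebras over a
commutative ring `R`, right DG modules, semifree DG modules, Ext via the Hom complex,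
homotopies, enveloping DG algebras, diagonal ideals, DG (quasi-)smoothness,
polynomial and free (divided power) extensions, and naive lifting.
-/

noncomputable section

/-- The Koszul sign `(-1)^i` for an integer `i`. -/
def ksign (i : ℤ) : ℤ := (((-1 : ℤˣ) ^ i : ℤˣ) : ℤ)

/-- A strongly commutative, non-negatively graded differential graded algebra over a
commutative ring `R`: a graded `R`-algebra `A = ⊕_{n ≥ 0} A_n` with
`a * b = (-1)^{|a||b|} b * a`, `a^2 = 0` for `|a|` odd, and an `R`-linear degree `-1`
differential `d` with `d ∘ d = 0` satisfying the Leibniz rule. -/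
structure DGAlgebra (R : Type) [CommRing R] where
  carrier : Type
  [ring : Ring carrier]
  [alg : Algebra R carrier]
  grading : ℤ → Submodule R carrier
  indep : ∀ i : ℤ, Disjoint (grading i) (⨆ j ≠ i, grading j)
  spanning : (⨆ i, grading i) = ⊤
  nonneg : ∀ i : ℤ, i < 0 → grading i = ⊥
  one_mem : (1 : carrier) ∈ grading 0
  mul_mem : ∀ {i j : ℤ} {a b : carrier}, a ∈ grading i → b ∈ grading j →
    a * b ∈ grading (i + j)
  gcomm : ∀ {i j : ℤ} (a b : carrier), a ∈ grading i → b ∈ grading j →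
    a * b = ksign (i * j) • (b * a)
  odd_sq : ∀ {i : ℤ} (a : carrier), Odd i → a ∈ grading i → a * a = 0
  d : carrier → carrier
  d_add : ∀ a b, d (a + b) = d a + d b
  d_rsmul : ∀ (r : R) a, d (r • a) = r • d a
  d_mem : ∀ {i : ℤ} {a : carrier}, a ∈ grading i → d a ∈ grading (i - 1)
  d_sq : ∀ a, d (d a) = 0
  leibniz : ∀ {i : ℤ} (a b : carrier), a ∈ grading i →
    d (a * b) = d a * b + ksign i • (a * d b)

attribute [instance] DGAlgebra.ring DGAlgebra.alg

variable {R : Type} [CommRing R]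

/-- A right DG module over a DG `R`-algebra `A`. -/
structure DGModule (R : Type) [CommRing R] (A : DGAlgebra R) where
  carrier : Type
  [acg : AddCommGroup carrier]
  [modR : Module R carrier]
  grading : ℤ → Submodule R carrier
  indep : ∀ i : ℤ, Disjoint (grading i) (⨆ j ≠ i, grading j)
  spanning : (⨆ i, grading i) = ⊤
  smul : carrier → A.carrier → carrier
  smul_add : ∀ (m : carrier) (a b : A.carrier), smul m (a + b) = smul m a + smul m b
  add_smul : ∀ (m n : carrier) (a : A.carrier), smul (m + n) a = smul m a + smul n a
  smul_rsmul : ∀ (r : R) (m : carrier) (a : A.carrier), smul m (r • a) = r • smul m a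
  rsmul_smul : ∀ (r : R) (m : carrier) (a : A.carrier), smul (r • m) a = r • smul m a
  smul_one : ∀ m : carrier, smul m 1 = m
  smul_mul : ∀ (m : carrier) (a b : A.carrier), smul (smul m a) b = smul m (a * b)
  smul_mem : ∀ {i j : ℤ} {m : carrier} {a : A.carrier},
    m ∈ grading i → a ∈ A.grading j → smul m a ∈ grading (i + j)
  d : carrier → carrier
  d_add : ∀ x y, d (x + y) = d x + d y
  d_rsmul : ∀ (r : R) x, d (r • x) = r • d x
  d_mem : ∀ {i : ℤ} {m : carrier}, m ∈ grading i → d m ∈ grading (i - 1)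
  d_sq : ∀ m, d (d m) = 0
  leibniz : ∀ {i : ℤ} (m : carrier) (a : A.carrier), m ∈ grading i →
    d (smul m a) = smul (d m) a + ksign i • smul m (A.d a)

attribute [instance] DGModule.acg DGModule.modR

/-- A graded `A`-linear map of degree `k` between DG `A`-modules (not necessarily
compatible with the differentials). -/
structure GradedHom {A : DGAlgebra R} (M N : DGModule R A) (k : ℤ) where
  toFun : M.carrier → N.carrier
  map_add : ∀ x y, toFun (x + y) = toFun x + toFun y
  map_rsmul : ∀ (r : R) x, toFun (r • x) = r • toFun x
  map_smul : ∀ (x : M.carrier) (a : A.carrier), toFun (M.smul x a) = N.smul (toFun x) a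
  map_mem : ∀ {i : ℤ} {x : M.carrier}, x ∈ M.grading i → toFun x ∈ N.grading (i + k)

/-- A homomorphism of DG `A`-modules: a degree `0` graded `A`-linear chain map. -/
structure DGHom {A : DGAlgebra R} (M N : DGModule R A) where
  toFun : M.carrier → N.carrier
  map_add : ∀ x y, toFun (x + y) = toFun x + toFun y
  map_rsmul : ∀ (r : R) x, toFun (r • x) = r • toFun x
  map_smul : ∀ (x : M.carrier) (a : A.carrier), toFun (M.smul x a) = N.smul (toFun x) a
  map_mem : ∀ {i : ℤ} {x : M.carrier}, x ∈ M.grading i → toFun x ∈ N.grading i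
  comm_d : ∀ x, toFun (M.d x) = N.d (toFun x)

/-- A degree `-k` element `f` of the Hom complex `Hom_A(N, M)` is a cocycle
(representing a class in `Ext^k_A(N,M) = H_{-k}(Hom_A(N,M))`). -/
def IsExtCocycle {A : DGAlgebra R} {N M : DGModule R A} (k : ℤ)
    (f : GradedHom N M (-k)) : Prop :=
  ∀ x, M.d (f.toFun x) = ksign k • f.toFun (N.d x)

/-- A degree `-k` cocycle of the Hom complex is a coboundary. -/
def IsExtCoboundary {A : DGAlgebra R} {N M : DGModule R A} (k : ℤ)
    (f : GradedHom N M (-k)) : Prop :=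
  ∃ h : GradedHom N M (-k + 1), ∀ x,
    f.toFun x = M.d (h.toFun x) + ksign k • h.toFun (N.d x)

/-- `Ext^k_A(N, M) = H_{-k}(Hom_A(N, M)) = 0`. -/
def ExtVanish {A : DGAlgebra R} (k : ℤ) (N M : DGModule R A) : Prop :=
  ∀ f : GradedHom N M (-k), IsExtCocycle k f → IsExtCoboundary k f

/-- A DG module homomorphism `j : M' → M` induces an isomorphism
`Ext^k_A(N, M') ≅ Ext^k_A(N, M)`; stated at the level of cocycles and coboundaries
of the Hom complexes (injectivity and surjectivity of the induced map on `H_{-k}`). -/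
def InducesExtIso {A : DGAlgebra R} (k : ℤ) (N : DGModule R A) {M' M : DGModule R A}
    (j : DGHom M' M) : Prop :=
  (∀ f : GradedHom N M' (-k), IsExtCocycle k f →
    (∃ h : GradedHom N M (-k + 1), ∀ x,
      j.toFun (f.toFun x) = M.d (h.toFun x) + ksign k • h.toFun (N.d x)) →
    IsExtCoboundary k f) ∧
  (∀ g : GradedHom N M (-k), IsExtCocycle k g →
    ∃ f : GradedHom N M' (-k), IsExtCocycle k f ∧
      ∃ h : GradedHom N M (-k + 1), ∀ x,
        j.toFun (f.toFun x) - g.toFun x = M.d (h.toFun x) + ksign k • h.toFun (N.d x))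

/-- Two maps of DG `A`-modules are homotopic: `f - g = ∂ ∘ h + h ∘ ∂` for a graded
`A`-linear map `h` of degree `1`. -/
def DGHomotopic {A : DGAlgebra R} {M N : DGModule R A}
    (f g : M.carrier → N.carrier) : Prop :=
  ∃ h : GradedHom M N 1, ∀ x, f x - g x = N.d (h.toFun x) + h.toFun (M.d x)

/-- A DG module homomorphism `j : M' → M` induces a bijection
`Hom_{K(A)}(N, M') ≅ Hom_{K(A)}(N, M)` on homotopy classes of DG homomorphisms. -/
def InducesHtpyBij {A : DGAlgebra R} (N : DGModule R A) {M' M : DGModule R A}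
    (j : DGHom M' M) : Prop :=
  (∀ f g : DGHom N M',
    DGHomotopic (fun x => j.toFun (f.toFun x)) (fun x => j.toFun (g.toFun x)) →
    DGHomotopic f.toFun g.toFun) ∧
  (∀ g : DGHom N M, ∃ f : DGHom N M',
    DGHomotopic (fun x => j.toFun (f.toFun x)) g.toFun)

/-- A semifree basis of a DG `A`-module `N` on a family `e : κ → N`: a well-ordering
of `κ`, degrees making each `e k` homogeneous, such that `e` is a basis of the
underlying graded `A`-module and `∂(e k) ∈ Σ_{j < k} (e j)·A`. -/
structure SemifreeBasisOn {A : DGAlgebra R} (N : DGModule R A) {κ : Type}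
    (e : κ → N.carrier) where
  lt : κ → κ → Prop
  wf : WellFounded lt
  trans : ∀ a b c, lt a b → lt b c → lt a c
  trichotomous : ∀ a b, lt a b ∨ a = b ∨ lt b a
  deg : κ → ℤ
  homog : ∀ k, e k ∈ N.grading (deg k)
  basis : Function.Bijective
    (fun c : κ →₀ A.carrier => c.sum fun k a => N.smul (e k) a)
  d_lower : ∀ k, ∃ c : κ →₀ A.carrier, (∀ j ∈ c.support, lt j k) ∧
    N.d (e k) = c.sum fun j a => N.smul (e j) a

/-- A DG `A`-module is semifree if it admits a semifree basis. -/
def IsSemifree {A : DGAlgebra R} (N : DGModule R A) : Prop :=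
  ∃ (κ : Type) (e : κ → N.carrier), Nonempty (SemifreeBasisOn N e)

/-- A DG `A`-module has a finite semifree basis. -/
def HasFiniteSemifreeBasis {A : DGAlgebra R} (N : DGModule R A) : Prop :=
  ∃ (κ : Type) (e : κ → N.carrier), Finite κ ∧ Nonempty (SemifreeBasisOn N e)

/-- A DG module is bounded below: `N_i = 0` for `i ≪ 0`. -/
def BoundedBelow {A : DGAlgebra R} (N : DGModule R A) : Prop :=
  ∃ n₀ : ℤ, ∀ i : ℤ, i < n₀ → N.grading i = ⊥

/-- A homomorphism of DG `R`-algebras. -/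
structure DGAlgHom (A B : DGAlgebra R) where
  toFun : A.carrier → B.carrier
  map_one : toFun 1 = 1
  map_mul : ∀ x y, toFun (x * y) = toFun x * toFun y
  map_add : ∀ x y, toFun (x + y) = toFun x + toFun y
  map_rsmul : ∀ (r : R) x, toFun (r • x) = r • toFun x
  map_mem : ∀ {i : ℤ} {x : A.carrier}, x ∈ A.grading i → toFun x ∈ B.grading i
  comm_d : ∀ x, toFun (A.d x) = B.d (toFun x)

/-- A DG `A`-module homomorphism from a DG `A`-module `M` to (the restriction of
scalars along `φ : A → B` of) a DG `B`-module `W`. -/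
structure ResHom {A B : DGAlgebra R} (φ : DGAlgHom A B) (M : DGModule R A)
    (W : DGModule R B) where
  toFun : M.carrier → W.carrier
  map_add : ∀ x y, toFun (x + y) = toFun x + toFun y
  map_rsmul : ∀ (r : R) x, toFun (r • x) = r • toFun x
  map_mem : ∀ {i : ℤ} {x : M.carrier}, x ∈ M.grading i → toFun x ∈ W.grading i
  map_smul : ∀ (x : M.carrier) (a : A.carrier),
    toFun (M.smul x a) = W.smul (toFun x) (φ.toFun a)
  comm_d : ∀ x, toFun (M.d x) = W.d (toFun x)

/-- `T` is (up to isomorphism) the base change `M ⊗_A B` of the DG `A`-module `M`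
along `φ : A → B`: universal property of the unit map `M → T`, `m ↦ m ⊗ 1`. -/
structure DGBaseChange {A B : DGAlgebra R} (φ : DGAlgHom A B) (M : DGModule R A)
    (T : DGModule R B) where
  unit : ResHom φ M T
  univ : ∀ (W : DGModule R B) (f : ResHom φ M W),
    ∃ g : DGHom T W, (∀ x, g.toFun (unit.toFun x) = f.toFun x) ∧
      ∀ g' : DGHom T W, (∀ x, g'.toFun (unit.toFun x) = f.toFun x) →
        ∀ t, g'.toFun t = g.toFun t

/-- A DG `B`-module `W` is liftable to `A` along `φ : A → B` if `W ≅ M ⊗_A B`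
for some DG `A`-module `M`. -/
def LiftableTo {A B : DGAlgebra R} (φ : DGAlgHom A B) (W : DGModule R B) : Prop :=
  ∃ M : DGModule R A, Nonempty (DGBaseChange φ M W)

/-- An `A`-linear (via `φ : A → B`) chain map between the restrictions of two
DG `B`-modules. -/
structure ResHomB {A B : DGAlgebra R} (φ : DGAlgHom A B) (N W : DGModule R B) where
  toFun : N.carrier → W.carrier
  map_add : ∀ x y, toFun (x + y) = toFun x + toFun y
  map_rsmul : ∀ (r : R) x, toFun (r • x) = r • toFun x
  map_mem : ∀ {i : ℤ} {x : N.carrier}, x ∈ N.grading i → toFun x ∈ W.grading i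
  map_smul : ∀ (x : N.carrier) (a : A.carrier),
    toFun (N.smul x (φ.toFun a)) = W.smul (toFun x) (φ.toFun a)
  comm_d : ∀ x, toFun (N.d x) = W.d (toFun x)

/-- `T` is (up to isomorphism) the induced DG `B`-module `N|_A ⊗_A B` of a
DG `B`-module `N` along `φ : A → B`, with unit map `n ↦ n ⊗ 1`. -/
structure InducedModuleSpec {A B : DGAlgebra R} (φ : DGAlgHom A B)
    (N T : DGModule R B) where
  unit : ResHomB φ N T
  univ : ∀ (W : DGModule R B) (f : ResHomB φ N W),
    ∃ g : DGHom T W, (∀ x, g.toFun (unit.toFun x) = f.toFun x) ∧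
      ∀ g' : DGHom T W, (∀ x, g'.toFun (unit.toFun x) = f.toFun x) →
        ∀ t, g'.toFun t = g.toFun t

/-- `N` is naively liftable to `A` along `φ : A → B`: the canonical DG `B`-module
epimorphism `π_N : N|_A ⊗_A B → N`, `n ⊗ b ↦ nb` (characterized as the unique
DG `B`-map splitting the unit) admits a right inverse DG `B`-module homomorphism. -/
def NaivelyLiftable {A B : DGAlgebra R} (φ : DGAlgHom A B) (N : DGModule R B) : Prop :=
  ∀ (T : DGModule R B) (h : InducedModuleSpec φ N T) (πN : DGHom T N),
    (∀ x, πN.toFun (h.unit.toFun x) = x) →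
    ∃ ρ : DGHom N T, ∀ y, πN.toFun (ρ.toFun y) = y

/-- `N` is a direct summand of `W` as DG modules. -/
def IsDGDirectSummandOf {A : DGAlgebra R} (N W : DGModule R A) : Prop :=
  ∃ (ρ : DGHom N W) (p : DGHom W N), ∀ x, p.toFun (ρ.toFun x) = x

/-- `N` is a direct summand of some DG `B`-module which is liftable to `A`. -/
def DirectSummandOfLiftable {A B : DGAlgebra R} (φ : DGAlgHom A B)
    (N : DGModule R B) : Prop :=
  ∃ W : DGModule R B, LiftableTo φ W ∧ IsDGDirectSummandOf N W

/-- `B` is free as an underlying graded `A`-module (via `φ : A → B`), with a basis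
of homogeneous elements. -/
def FreeOverBase {A B : DGAlgebra R} (φ : DGAlgHom A B) : Prop :=
  ∃ (κ : Type) (e : κ → B.carrier) (dg : κ → ℤ),
    (∀ k, e k ∈ B.grading (dg k)) ∧
    Function.Bijective (fun c : κ →₀ A.carrier => c.sum fun k a => e k * φ.toFun a)

/-- `E` is (up to isomorphism) the enveloping DG algebra `B^e = B^o ⊗_A B` of
`φ : A → B`: it receives the two canonical maps `l : B° → E`, `b ↦ b^o ⊗ 1` and
`r : B → E`, `b ↦ 1^o ⊗ b` agreeing on `A`, and is universal (as a pushout of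
strongly commutative DG algebras) with this property. -/
structure EnvelopingAlg {A B : DGAlgebra R} (φ : DGAlgHom A B) (E : DGAlgebra R) where
  l : DGAlgHom B E
  r : DGAlgHom B E
  compat : ∀ a, l.toFun (φ.toFun a) = r.toFun (φ.toFun a)
  univ : ∀ (C : DGAlgebra R) (f g : DGAlgHom B C),
    (∀ a, f.toFun (φ.toFun a) = g.toFun (φ.toFun a)) →
    ∃ h : DGAlgHom E C, (∀ b, h.toFun (l.toFun b) = f.toFun b) ∧
      (∀ b, h.toFun (r.toFun b) = g.toFun b) ∧
      ∀ h' : DGAlgHom E C,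
        ((∀ b, h'.toFun (l.toFun b) = f.toFun b) ∧
          (∀ b, h'.toFun (r.toFun b) = g.toFun b)) → ∀ x, h'.toFun x = h.toFun x

/-- The diagonal ideal `J = ker(π_B : B^e → B)`. -/
def diagIdeal {A B E : DGAlgebra R} {φ : DGAlgHom A B} (_ : EnvelopingAlg φ E)
    (πB : DGAlgHom E B) : Set E.carrier :=
  {x | πB.toFun x = 0}

/-- A balanced pairing `N × S → W` realizing (maps out of) `N ⊗_B (S/Z)`, where
`S ⊆ B^e` is a DG `(B,B)`-sub-bimodule of `B^e` (left `B`-action via `l`, right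
`B`-action via `r`) and `Z ⊆ S` is killed. -/
structure TensorPairing {A B E : DGAlgebra R} (φ : DGAlgHom A B)
    (he : EnvelopingAlg φ E) (S Z : Set E.carrier) (N W : DGModule R B) where
  pair : N.carrier → E.carrier → W.carrier
  add_left : ∀ n n' x, x ∈ S → pair (n + n') x = pair n x + pair n' x
  add_right : ∀ n x y, x ∈ S → y ∈ S → pair n (x + y) = pair n x + pair n y
  rsmul_left : ∀ (r : R) n x, x ∈ S → pair (r • n) x = r • pair n x
  rsmul_right : ∀ (r : R) n x, x ∈ S → pair n (r • x) = r • pair n x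
  balanced : ∀ (n : N.carrier) (b : B.carrier) (x : E.carrier), x ∈ S →
    pair (N.smul n b) x = pair n (he.l.toFun b * x)
  act_right : ∀ (n : N.carrier) (b : B.carrier) (x : E.carrier), x ∈ S →
    pair n (x * he.r.toFun b) = W.smul (pair n x) b
  grade : ∀ {i j : ℤ} (n : N.carrier) (x : E.carrier),
    n ∈ N.grading i → x ∈ S → x ∈ E.grading j → pair n x ∈ W.grading (i + j)
  chain : ∀ {i : ℤ} (n : N.carrier) (x : E.carrier), n ∈ N.grading i → x ∈ S →
    W.d (pair n x) = pair (N.d n) x + ksign i • pair n (E.d x)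
  kill : ∀ n x, x ∈ Z → pair n x = 0

/-- `P` is (up to isomorphism) the right DG `B`-module `N ⊗_B (S/Z)`:
universal property among balanced pairings. -/
structure IsTensorSubquot {A B E : DGAlgebra R} (φ : DGAlgHom A B)
    (he : EnvelopingAlg φ E) (S Z : Set E.carrier) (N P : DGModule R B) where
  pairing : TensorPairing φ he S Z N P
  univ : ∀ (W : DGModule R B) (γ : TensorPairing φ he S Z N W),
    ∃ g : DGHom P W, (∀ n x, x ∈ S → g.toFun (pairing.pair n x) = γ.pair n x) ∧
      ∀ g' : DGHom P W, (∀ n x, x ∈ S → g'.toFun (pairing.pair n x) = γ.pair n x) →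
        ∀ p, g'.toFun p = g.toFun p

/-- `Q` is (up to isomorphism) the quotient `S/Z` of DG `B^e`-submodules
`Z ⊆ S ⊆ B^e`, regarded as a right DG `B`-module via `r : B → B^e`. -/
structure SubquotModSpec {A B E : DGAlgebra R} {φ : DGAlgHom A B}
    (he : EnvelopingAlg φ E) (S Z : Set E.carrier) (Q : DGModule R B) where
  q : E.carrier → Q.carrier
  q_add : ∀ x y, x ∈ S → y ∈ S → q (x + y) = q x + q y
  q_rsmul : ∀ (r : R) x, x ∈ S → q (r • x) = r • q x
  q_mem : ∀ {i : ℤ} (x : E.carrier), x ∈ S → x ∈ E.grading i → q x ∈ Q.grading i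
  q_d : ∀ x, x ∈ S → q (E.d x) = Q.d (q x)
  q_act : ∀ (x : E.carrier) (b : B.carrier), x ∈ S →
    q (x * he.r.toFun b) = Q.smul (q x) b
  q_surj : ∀ y, ∃ x ∈ S, q x = y
  q_ker : ∀ x, x ∈ S → (q x = 0 ↔ x ∈ Z)

/-- The data exhibiting `φ : A → B` as DG quasi-smooth, relative to a realization
`E` of the enveloping DG algebra `B^e` and the multiplication map `π_B : B^e → B`:
`B` is graded-free over `A` and the diagonal ideal `J = ker π_B` carries a filtration
`J = J^[1] ⊇ J^[2] ⊇ ⋯` of DG `B^e`-submodules with `J·J^[ℓ] + J^[ℓ]·J ⊆ J^[ℓ+1]`,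
`inf J^[ℓ] ≥ ℓ`, and all subquotients `J^[ℓ]/J^[ℓ+1]` semifree over `B`. -/
structure QuasiSmoothData {A B : DGAlgebra R} (φ : DGAlgHom A B) (E : DGAlgebra R)
    (he : EnvelopingAlg φ E) (πB : DGAlgHom E B) where
  pil : ∀ b, πB.toFun (he.l.toFun b) = b
  pir : ∀ b, πB.toFun (he.r.toFun b) = b
  free : FreeOverBase φ
  filt : ℕ → Set E.carrier
  filt_one : filt 1 = {x | πB.toFun x = 0}
  filt_desc : ∀ ℓ, 1 ≤ ℓ → filt (ℓ + 1) ⊆ filt ℓ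
  filt_zero : ∀ ℓ, (0 : E.carrier) ∈ filt ℓ
  filt_add : ∀ ℓ x y, x ∈ filt ℓ → y ∈ filt ℓ → x + y ∈ filt ℓ
  filt_neg : ∀ ℓ x, x ∈ filt ℓ → -x ∈ filt ℓ
  filt_rsmul : ∀ ℓ (r : R) x, x ∈ filt ℓ → r • x ∈ filt ℓ
  filt_act : ∀ ℓ (e : E.carrier) x, x ∈ filt ℓ → x * e ∈ filt ℓ
  filt_d : ∀ ℓ x, x ∈ filt ℓ → E.d x ∈ filt ℓ
  filt_graded : ∀ ℓ x, x ∈ filt ℓ →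
    x ∈ Submodule.span R (filt ℓ ∩ ⋃ i : ℤ, (E.grading i : Set E.carrier))
  filt_mul : ∀ ℓ, 1 ≤ ℓ → ∀ a x, πB.toFun a = 0 → x ∈ filt ℓ →
    a * x ∈ filt (ℓ + 1) ∧ x * a ∈ filt (ℓ + 1)
  filt_inf : ∀ ℓ : ℕ, 1 ≤ ℓ → ∀ i : ℤ, i < (ℓ : ℤ) →
    ∀ x ∈ filt ℓ, x ∈ E.grading i → x = 0
  quot_semifree : ∀ ℓ, 1 ≤ ℓ → ∃ Q : DGModule R B,
    Nonempty (SubquotModSpec he (filt ℓ) (filt (ℓ + 1)) Q) ∧ IsSemifree Q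

/-- The data exhibiting `φ : A → B` as DG smooth: quasi-smooth, and all
subquotients `J^[ℓ]/J^[ℓ+1]` have finite semifree bases. -/
structure SmoothData {A B : DGAlgebra R} (φ : DGAlgHom A B) (E : DGAlgebra R)
    (he : EnvelopingAlg φ E) (πB : DGAlgHom E B)
    extends QuasiSmoothData φ E he πB where
  quot_finite : ∀ ℓ, 1 ≤ ℓ → ∃ Q : DGModule R B,
    Nonempty (SubquotModSpec he (filt ℓ) (filt (ℓ + 1)) Q) ∧ HasFiniteSemifreeBasis Q

/-- A DG `A`-submodule of a DG `A`-module `M`: an `R`-submodule closed under the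
`A`-action and the differential and generated by homogeneous elements. -/
structure DGSubmodule {A : DGAlgebra R} (M : DGModule R A) where
  toSubmodule : Submodule R M.carrier
  smul_mem' : ∀ (x : M.carrier) (a : A.carrier), x ∈ toSubmodule →
    M.smul x a ∈ toSubmodule
  d_mem' : ∀ x ∈ toSubmodule, M.d x ∈ toSubmodule
  graded' : ∀ x ∈ toSubmodule, x ∈ Submodule.span R
    ((toSubmodule : Set M.carrier) ∩ ⋃ i : ℤ, (M.grading i : Set M.carrier))

/-- `P` (with projections `proj`) is the direct product of the family `Ms` in the
category of DG `A`-modules. -/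
def IsDGProduct {A : DGAlgebra R} (Ms : ℕ → DGModule R A) (P : DGModule R A)
    (proj : ∀ ℓ, DGHom P (Ms ℓ)) : Prop :=
  ∀ (W : DGModule R A) (f : ∀ ℓ, DGHom W (Ms ℓ)),
    ∃ g : DGHom W P, (∀ ℓ x, (proj ℓ).toFun (g.toFun x) = (f ℓ).toFun x) ∧
      ∀ g' : DGHom W P, (∀ ℓ x, (proj ℓ).toFun (g'.toFun x) = (f ℓ).toFun x) →
        ∀ x, g'.toFun x = g.toFun x

/-- `M'` is the `k`-th shift `Σ^k M` of the DG `A`-module `M`. -/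
structure DGShiftSpec {A : DGAlgebra R} (k : ℤ) (M M' : DGModule R A) where
  toFun : M.carrier → M'.carrier
  bij : Function.Bijective toFun
  map_add : ∀ x y, toFun (x + y) = toFun x + toFun y
  map_rsmul : ∀ (r : R) x, toFun (r • x) = r • toFun x
  map_mem : ∀ {i : ℤ} (x : M.carrier), x ∈ M.grading i → toFun x ∈ M'.grading (i + k)
  map_smul : ∀ (x : M.carrier) (a : A.carrier), toFun (M.smul x a) = M'.smul (toFun x) a
  map_d : ∀ x, M'.d (toFun x) = ksign k • toFun (M.d x)

/-- `C` is the mapping cone of `f : X → Y`: a degreewise split extension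
`0 → Y → C → ΣX → 0` whose twisting term is `f`. -/
structure DGConeSpec {A : DGAlgebra R} {X Y : DGModule R A} (f : DGHom X Y)
    (C : DGModule R A) where
  inl : DGHom Y C
  inl_inj : Function.Injective inl.toFun
  pr : GradedHom C X (-1)
  pr_d : ∀ c, pr.toFun (C.d c) = - X.d (pr.toFun c)
  sec : GradedHom X C 1
  pr_sec : ∀ x, pr.toFun (sec.toFun x) = x
  pr_inl : ∀ y, pr.toFun (inl.toFun y) = 0
  split : ∀ c, ∃ y, c = inl.toFun y + sec.toFun (pr.toFun c)
  sec_d : ∀ x, C.d (sec.toFun x) = - sec.toFun (X.d x) + inl.toFun (f.toFun x)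

/-- A system of divided powers on (the homogeneous elements of positive even degree
of) a DG `R`-algebra. -/
structure DGDividedPowers (A : DGAlgebra R) where
  dpow : ℕ → A.carrier → A.carrier
  dpow_zero : ∀ {i : ℤ} (u : A.carrier), 0 < i → Even i → u ∈ A.grading i →
    dpow 0 u = 1
  dpow_one : ∀ {i : ℤ} (u : A.carrier), 0 < i → Even i → u ∈ A.grading i →
    dpow 1 u = u
  dpow_mem : ∀ {i : ℤ} (u : A.carrier) (m : ℕ), 0 < i → Even i → u ∈ A.grading i →
    dpow m u ∈ A.grading ((m : ℤ) * i)
  dpow_mul : ∀ {i : ℤ} (u : A.carrier) (m l : ℕ), 0 < i → Even i → u ∈ A.grading i →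
    dpow m u * dpow l u = ((m + l).choose m : ℤ) • dpow (m + l) u
  dpow_add : ∀ {i : ℤ} (u v : A.carrier) (m : ℕ), 0 < i → Even i →
    u ∈ A.grading i → v ∈ A.grading i →
    dpow m (u + v) = ∑ j ∈ Finset.range (m + 1), dpow j u * dpow (m - j) v
  dpow_odd_mul : ∀ {i j : ℤ} (u v : A.carrier) (m : ℕ), Odd i → Odd j →
    u ∈ A.grading i → v ∈ A.grading j → 2 ≤ m → dpow m (u * v) = 0
  dpow_even_mul : ∀ {i j : ℤ} (u v : A.carrier) (m : ℕ), Even i → Even j → 0 < j →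
    u ∈ A.grading i → v ∈ A.grading j → dpow m (u * v) = u ^ m * dpow m v
  dpow_comp : ∀ {i : ℤ} (u : A.carrier) (m l : ℕ), 0 < i → Even i →
    u ∈ A.grading i → 1 ≤ m →
    dpow l (dpow m u) =
      (Nat.factorial (m * l) / (Nat.factorial l * (Nat.factorial m) ^ l)) •
        dpow (m * l) u

/-- The index set of monomials in variables `ι` (with divided/ordinary powers):
finitely supported exponent functions, with exponents at most `1` on odd-degree
variables. -/
def MonIdx (ι : Type) (degX : ι → ℤ) : Type :=
  {m : ι →₀ ℕ // ∀ i, Odd (degX i) → m i ≤ 1}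

/-- Total weight (number of symbols) of a monomial index. -/
def monWeight {ι : Type} {degX : ι → ℤ} (m : MonIdx ι degX) : ℕ :=
  m.1.sum fun _ k => k

/-- The monomial `∏_i g i (m i)` (product taken in the increasing order of the
variables). -/
def gradMonomial {T : Type} [Ring T] {ι : Type} [LinearOrder ι] (degX : ι → ℤ)
    (g : ι → ℕ → T) (m : MonIdx ι degX) : T :=
  ((m.1.support.sort (· ≤ ·)).map fun i => g i (m.1 i)).prod

/-- `B = A[X_i : i ∈ ι]` is a polynomial extension of `A` by the variables `X_i`
of positive degrees `degX i`, adjoined in increasing order of degree, each `d X_i`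
lying in the preceding stage; the monomials in the `X_i` form a basis of `B` as a
graded `A`-module. -/
structure PolyExt {A B : DGAlgebra R} (φ : DGAlgHom A B) (ι : Type) [LinearOrder ι]
    (X : ι → B.carrier) (degX : ι → ℤ) where
  inj : Function.Injective φ.toFun
  pos_deg : ∀ i, 0 < degX i
  mono_deg : Monotone degX
  homog : ∀ i, X i ∈ B.grading (degX i)
  d_prev : ∀ i : ι, ∃ c : MonIdx ι degX →₀ A.carrier,
    (∀ m ∈ c.support, ∀ j : ι, i ≤ j → m.1 j = 0) ∧
    B.d (X i) = c.sum fun m a =>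
      gradMonomial degX (fun i' k => X i' ^ k) m * φ.toFun a
  basis : Function.Bijective (fun c : MonIdx ι degX →₀ A.carrier =>
    c.sum fun m a => gradMonomial degX (fun i' k => X i' ^ k) m * φ.toFun a)

/-- `B = A⟨X_i : i ∈ ι⟩` is a free (divided power) extension of `A` by the
variables `X_i` of positive degrees: odd variables square to zero, even variables
carry divided powers `dp i m` with `d(X^{(m)}) = X^{(m-1)} dX`, and the divided
power monomials form a basis of `B` as a graded `A`-module. -/
structure FreeExt {A B : DGAlgebra R} (φ : DGAlgHom A B) (ι : Type) [LinearOrder ι]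
    (X : ι → B.carrier) (degX : ι → ℤ) where
  inj : Function.Injective φ.toFun
  pos_deg : ∀ i, 0 < degX i
  mono_deg : Monotone degX
  homog : ∀ i, X i ∈ B.grading (degX i)
  dp : ι → ℕ → B.carrier
  dp_zero : ∀ i, dp i 0 = 1
  dp_one : ∀ i, dp i 1 = X i
  dp_odd : ∀ i m, Odd (degX i) → 2 ≤ m → dp i m = 0
  dp_mem : ∀ i (m : ℕ), dp i m ∈ B.grading ((m : ℤ) * degX i)
  dp_mul : ∀ i (m l : ℕ), dp i m * dp i l = ((m + l).choose m : ℤ) • dp i (m + l)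
  dp_d : ∀ i (m : ℕ), 1 ≤ m → B.d (dp i m) = dp i (m - 1) * B.d (X i)
  d_prev : ∀ i : ι, ∃ c : MonIdx ι degX →₀ A.carrier,
    (∀ m ∈ c.support, ∀ j : ι, i ≤ j → m.1 j = 0) ∧
    B.d (X i) = c.sum fun m a => gradMonomial degX dp m * φ.toFun a
  basis : Function.Bijective (fun c : MonIdx ι degX →₀ A.carrier =>
    c.sum fun m a => gradMonomial degX dp m * φ.toFun a)

/-- The diagonal `ξ_i = X_i^o ⊗ 1 - 1^o ⊗ X_i` of the variable `X_i` in `B^e`. -/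
def xiDiag {A B E : DGAlgebra R} {φ : DGAlgHom A B} (he : EnvelopingAlg φ E)
    {ι : Type} (X : ι → B.carrier) (i : ι) : E.carrier :=
  he.l.toFun (X i) - he.r.toFun (X i)

/-- The divided powers `ξ_i^{(m)} = Σ_{j=0}^m (-1)^{m-j} (X_i^{(j)})^o ⊗ X_i^{(m-j)}`
of the diagonal `ξ_i` in `B^e` (zero for `m ≥ 2` when `|X_i|` is odd). -/
def xiDp {A B E : DGAlgebra R} {φ : DGAlgHom A B} (he : EnvelopingAlg φ E)
    {ι : Type} (dp : ι → ℕ → B.carrier) (degX : ι → ℤ) (i : ι) (m : ℕ) :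
    E.carrier :=
  if Odd (degX i) ∧ 2 ≤ m then 0
  else ∑ j ∈ Finset.range (m + 1),
    ((-1 : ℤ) ^ (m - j)) • (he.l.toFun (dp i j) * he.r.toFun (dp i (m - j)))

/-- The monomial `ξ^{(m)} = ξ_{i_1}^{(m_{i_1})} ⋯ ξ_{i_t}^{(m_{i_t})}` in `B^e`
built from the divided powers of the diagonals. -/
def FreeExt.diagMon {A B E : DGAlgebra R} {φ : DGAlgHom A B}
    {ι : Type} [LinearOrder ι] {X : ι → B.carrier} {degX : ι → ℤ}
    (fe : FreeExt φ ι X degX) (he : EnvelopingAlg φ E) (m : MonIdx ι degX) :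
    E.carrier :=
  gradMonomial degX (xiDp he fe.dp degX) m

/-- The `ℓ`-th power `J^{(ℓ)} = Mon_{≥ℓ}(Ω)·B^e` of the diagonal ideal:
right `B^e`-linear combinations of the `ξ`-monomials of weight at least `ℓ`. -/
def FreeExt.diagPow {A B E : DGAlgebra R} {φ : DGAlgHom A B}
    {ι : Type} [LinearOrder ι] {X : ι → B.carrier} {degX : ι → ℤ}
    (fe : FreeExt φ ι X degX) (he : EnvelopingAlg φ E) (ℓ : ℕ) :
    Set E.carrier :=
  {x | ∃ c : MonIdx ι degX →₀ E.carrier, (∀ m ∈ c.support, ℓ ≤ monWeight m) ∧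
    x = c.sum fun m e => fe.diagMon he m * e}

/-- Ordinary-power analogue `J^ℓ` for polynomial extensions. -/
def PolyExt.diagPow {A B E : DGAlgebra R} {φ : DGAlgHom A B}
    {ι : Type} [LinearOrder ι] {X : ι → B.carrier} {degX : ι → ℤ}
    (_ : PolyExt φ ι X degX) (he : EnvelopingAlg φ E) (ℓ : ℕ) :
    Set E.carrier :=
  {x | ∃ c : MonIdx ι degX →₀ E.carrier, (∀ m ∈ c.support, ℓ ≤ monWeight m) ∧
    x = c.sum fun m e =>
      gradMonomial degX (fun i k => (xiDiag he X i) ^ k) m * e}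

/-- Additive closure of the set of products `a * b` with `a ∈ S₁`, `b ∈ S₂`. -/
def setMulClosure {T : Type} [Ring T] (S₁ S₂ : Set T) : Set T :=
  (AddSubmonoid.closure {x | ∃ a ∈ S₁, ∃ b ∈ S₂, x = a * b} : AddSubmonoid T)

/-- The right ideal generated by a set. -/
def rightIdealGen {T : Type} [Ring T] (S : Set T) : Set T :=
  (AddSubmonoid.closure {x | ∃ s ∈ S, ∃ e : T, x = s * e} : AddSubmonoid T)

/-- The two-sided ideal generated by a set. -/
def twoSidedGen {T : Type} [Ring T] (S : Set T) : Set T :=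
  (AddSubmonoid.closure {x | ∃ s ∈ S, ∃ e e' : T, x = e * s * e'} : AddSubmonoid T)

end

namespace DGModule

variable {R : Type} [CommRing R] {A : DGAlgebra R}

/-- The differential of a DG module as an additive map. -/
def dAddHom (M : DGModule R A) : M.carrier →+ M.carrier :=
  AddMonoidHom.mk' M.d M.d_add

/-- The action of a fixed element of `A` as an additive map. -/
def smulAddHom (M : DGModule R A) (a : A.carrier) : M.carrier →+ M.carrier :=
  AddMonoidHom.mk' (fun m => M.smul m a) fun m n => M.add_smul m n a

end DGModule

namespace GradedHom

variable {R : Type} [CommRing R] {A : DGAlgebra R} {L M N : DGModule R A} {k : ℤ}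

theorem map_zero (f : GradedHom M N k) : f.toFun 0 = 0 :=
  (AddMonoidHom.mk' f.toFun f.map_add).map_zero

/-- The negative of a graded homomorphism. -/
def neg (f : GradedHom M N k) : GradedHom M N k where
  toFun x := -f.toFun x
  map_add x y := by rw [f.map_add, neg_add]
  map_rsmul r x := by rw [f.map_rsmul, smul_neg]
  map_smul x a := by
    rw [f.map_smul]
    exact ((N.smulAddHom a).map_neg _).symm
  map_mem hx := neg_mem (f.map_mem hx)

/-- The sum of two graded homomorphisms of the same degree. -/
def add (f g : GradedHom M N k) : GradedHom M N k where
  toFun x := f.toFun x + g.toFun x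
  map_add x y := by rw [f.map_add, g.map_add, add_add_add_comm]
  map_rsmul r x := by rw [f.map_rsmul, g.map_rsmul, smul_add]
  map_smul x a := by rw [f.map_smul, g.map_smul, N.add_smul]
  map_mem hx := add_mem (f.map_mem hx) (g.map_mem hx)

/-- Composition of a graded homomorphism with a DG homomorphism. -/
def postcomp (j : DGHom M N) (f : GradedHom L M k) : GradedHom L N k where
  toFun x := j.toFun (f.toFun x)
  map_add x y := by rw [f.map_add, j.map_add]
  map_rsmul r x := by rw [f.map_rsmul, j.map_rsmul]
  map_smul x a := by rw [f.map_smul, j.map_smul]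
  map_mem hx := j.map_mem (f.map_mem hx)

/-- A pointwise eventually zero sequence of graded homomorphisms has a sum. -/
theorem exists_sum (H : ℕ → GradedHom M N k)
    (hH : ∀ x, ∃ n, ∀ m, n ≤ m → (H m).toFun x = 0) :
    ∃ h : GradedHom M N k, ∀ x, ∃ n, ∀ m, n ≤ m →
      h.toFun x = ∑ l ∈ Finset.range m, (H l).toFun x := by
  have key : ∀ x, ∃ n, ∀ m, n ≤ m →
      ∑ᶠ l, (H l).toFun x = ∑ l ∈ Finset.range m, (H l).toFun x := fun x => by
    obtain ⟨n, hn⟩ := hH x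
    refine ⟨n, fun m hm => finsum_eq_sum_of_support_subset _ fun l hl => ?_⟩
    by_contra h
    exact hl (hn l (hm.trans (by simpa using h)))
  refine ⟨⟨fun x => ∑ᶠ l, (H l).toFun x, fun x y => ?_, fun r x => ?_, fun x a => ?_,
    fun {i x} hx => ?_⟩, key⟩
  · obtain ⟨n₁, h₁⟩ := key x
    obtain ⟨n₂, h₂⟩ := key y
    obtain ⟨n₃, h₃⟩ := key (x + y)
    rw [h₁ (n₁ + n₂ + n₃) (by lia), h₂ (n₁ + n₂ + n₃) (by lia), h₃ (n₁ + n₂ + n₃) (by lia),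
      ← Finset.sum_add_distrib]
    exact Finset.sum_congr rfl fun l _ => (H l).map_add x y
  · obtain ⟨n₁, h₁⟩ := key x
    obtain ⟨n₂, h₂⟩ := key (r • x)
    rw [h₁ (n₁ + n₂) (by lia), h₂ (n₁ + n₂) (by lia), Finset.smul_sum]
    exact Finset.sum_congr rfl fun l _ => (H l).map_rsmul r x
  · obtain ⟨n₁, h₁⟩ := key x
    obtain ⟨n₂, h₂⟩ := key (M.smul x a)
    rw [h₁ (n₁ + n₂) (by lia), h₂ (n₁ + n₂) (by lia)]
    refine Eq.trans ?_ (map_sum (N.smulAddHom a) _ _).symm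
    exact Finset.sum_congr rfl fun l _ => (H l).map_smul x a
  · obtain ⟨n, hn⟩ := key x
    rw [hn n le_rfl]
    exact sum_mem fun l _ => (H l).map_mem hx

/-- If the graded pieces of the targets vanish below degrees tending to infinity, a
sequence of graded homomorphisms is pointwise eventually zero. -/
theorem eventually_eq_zero {Ms : ℕ → DGModule R A}
    (hinf : ∀ n : ℤ, ∃ L : ℕ, ∀ l : ℕ, L ≤ l → ∀ i : ℤ, i < n → (Ms l).grading i = ⊥)
    (H : ∀ l, GradedHom N (Ms l) k) (x : N.carrier) :
    ∃ n, ∀ m, n ≤ m → (H m).toFun x = 0 := by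
  have hx : x ∈ ⨆ i, N.grading i := N.spanning ▸ Submodule.mem_top
  induction hx using Submodule.iSup_induction' with
  | mem i x hx =>
    obtain ⟨n, hn⟩ := hinf (i + k + 1)
    refine ⟨n, fun m hm => ?_⟩
    have h := (H m).map_mem hx
    rwa [hn m hm _ (lt_add_one _), Submodule.mem_bot] at h
  | zero => exact ⟨0, fun m _ => (H m).map_zero⟩
  | add x y _ _ hx hy =>
    obtain ⟨n₁, h₁⟩ := hx
    obtain ⟨n₂, h₂⟩ := hy
    refine ⟨max n₁ n₂, fun m hm => ?_⟩
    rw [(H m).map_add, h₁ m (le_of_max_le_left hm), h₂ m (le_of_max_le_right hm), add_zero]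

end GradedHom

namespace DGHom

variable {R : Type} [CommRing R] {A : DGAlgebra R} {L M N : DGModule R A}

theorem map_sub (f : DGHom M N) (x y : M.carrier) :
    f.toFun (x - y) = f.toFun x - f.toFun y :=
  (AddMonoidHom.mk' f.toFun f.map_add).map_sub x y

theorem map_zero (f : DGHom M N) : f.toFun 0 = 0 :=
  (AddMonoidHom.mk' f.toFun f.map_add).map_zero

/-- A DG homomorphism as a graded homomorphism of degree `0`. -/
def toGradedHom (f : DGHom M N) : GradedHom M N 0 where
  toFun := f.toFun
  map_add := f.map_add
  map_rsmul := f.map_rsmul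
  map_smul := f.map_smul
  map_mem {i x} hx := by simpa using f.map_mem hx

/-- Composition of DG homomorphisms. -/
def comp (g : DGHom M N) (f : DGHom L M) : DGHom L N where
  toFun x := g.toFun (f.toFun x)
  map_add x y := by rw [f.map_add, g.map_add]
  map_rsmul r x := by rw [f.map_rsmul, g.map_rsmul]
  map_smul x a := by rw [f.map_smul, g.map_smul]
  map_mem hx := g.map_mem (f.map_mem hx)
  comm_d x := by rw [f.comm_d, g.comm_d]

/-- An injective DG homomorphism reflects degrees. -/
theorem mem_grading_of_injective {j : DGHom M N} (hj : Function.Injective j.toFun) {i : ℤ}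
    {y : M.carrier} (hy : j.toFun y ∈ N.grading i) : y ∈ M.grading i := by
  have hsup : M.grading i ⊔ ⨆ k ≠ i, M.grading k = ⊤ := by
    rw [← M.spanning, ← iSup_split_single]
  obtain ⟨a, ha, b, hb, rfl⟩ := Submodule.mem_sup.1 (hsup ▸ Submodule.mem_top : y ∈ _)
  let j' : M.carrier →ₗ[R] N.carrier := ⟨⟨j.toFun, j.map_add⟩, j.map_rsmul⟩
  have hle : ⨆ k ≠ i, M.grading k ≤ (⨆ k ≠ i, N.grading k).comap j' :=
    iSup₂_le fun k hk x hx =>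
      (le_iSup₂ (f := fun k (_ : k ≠ i) => N.grading k) k hk) (j.map_mem hx)
  have hbi : j.toFun b ∈ N.grading i := by
    rw [j.map_add] at hy
    exact (Submodule.add_mem_iff_right _ (j.map_mem ha)).1 hy
  have hb0 : j.toFun b = 0 := Submodule.disjoint_def.1 (N.indep i) _ hbi (hle hb)
  rw [hj (hb0.trans j.map_zero.symm), add_zero]
  exact ha

/-- A DG homomorphism whose range is contained in that of an injective one factors through
it. -/
theorem exists_factor {j : DGHom M N} (hj : Function.Injective j.toFun) (g : DGHom L N)
    (hr : Set.range g.toFun ⊆ Set.range j.toFun) :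
    ∃ t : DGHom L M, ∀ x, j.toFun (t.toFun x) = g.toFun x := by
  choose t ht using fun x => hr (Set.mem_range_self x)
  exact ⟨{ toFun := t
           map_add := fun x y => hj (by rw [j.map_add, ht, ht, ht, g.map_add])
           map_rsmul := fun r x => hj (by rw [j.map_rsmul, ht, ht, g.map_rsmul])
           map_smul := fun x a => hj (by rw [j.map_smul, ht, ht, g.map_smul])
           map_mem := fun {i x} hx => mem_grading_of_injective hj (by
             rw [ht]
             exact g.map_mem hx)
           comm_d := fun x => hj (by rw [j.comm_d, ht, ht, g.comm_d]) }, ht⟩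

end DGHom

namespace DGHomotopic

variable {R : Type} [CommRing R] {A : DGAlgebra R} {M N : DGModule R A}

theorem symm {f g : M.carrier → N.carrier} (h : DGHomotopic f g) : DGHomotopic g f := by
  obtain ⟨s, hs⟩ := h
  refine ⟨s.neg, fun x => ?_⟩
  have hd : N.d (-s.toFun x) = -N.d (s.toFun x) := N.dAddHom.map_neg _
  change g x - f x = N.d (-s.toFun x) + -s.toFun (M.d x)
  rw [hd, ← neg_add, ← hs, neg_sub]

theorem trans {f g k : M.carrier → N.carrier} (h₁ : DGHomotopic f g)
    (h₂ : DGHomotopic g k) : DGHomotopic f k := by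
  obtain ⟨s, hs⟩ := h₁
  obtain ⟨t, ht⟩ := h₂
  refine ⟨s.add t, fun x => ?_⟩
  change f x - k x = N.d (s.toFun x + t.toFun x) + (s.toFun (M.d x) + t.toFun (M.d x))
  rw [N.d_add, add_add_add_comm, ← hs, ← ht, sub_add_sub_cancel]

/-- Telescoping: if consecutive maps of a pointwise eventually zero sequence are homotopic
via pointwise eventually zero homotopies, then the first map is null-homotopic. -/
theorem zero_of_telescope (F : ℕ → M.carrier → N.carrier) (H : ℕ → GradedHom M N 1)
    (hF : ∀ x, ∃ n, ∀ m, n ≤ m → F m x = 0)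
    (hH : ∀ x, ∃ n, ∀ m, n ≤ m → (H m).toFun x = 0)
    (hFH : ∀ l x, F l x - F (l + 1) x = N.d ((H l).toFun x) + (H l).toFun (M.d x)) :
    DGHomotopic (F 0) (fun _ => (0 : N.carrier)) := by
  obtain ⟨h, hh⟩ := GradedHom.exists_sum H hH
  refine ⟨h, fun x => ?_⟩
  obtain ⟨n₀, h₀⟩ := hF x
  obtain ⟨n₁, h₁⟩ := hh x
  obtain ⟨n₂, h₂⟩ := hh (M.d x)
  have hd : N.d (∑ l ∈ Finset.range (n₀ + n₁ + n₂), (H l).toFun x) =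
      ∑ l ∈ Finset.range (n₀ + n₁ + n₂), N.d ((H l).toFun x) := map_sum N.dAddHom _ _
  rw [h₁ (n₀ + n₁ + n₂) (by lia), h₂ (n₀ + n₁ + n₂) (by lia), hd, ← Finset.sum_add_distrib,
    ← h₀ (n₀ + n₁ + n₂) (by lia), ← Finset.sum_range_sub' (fun l => F l x)]
  exact Finset.sum_congr rfl fun l _ => hFH l x

end DGHomotopic

/-- Let `M` and `N` be DG `A`-modules with `M` bounded below and
`N` semifree, and let `M = M^0 ⊇ M^1 ⊇ ⋯` be a descending sequence of DG
`A`-submodules of `M` (realized by the DG modules `Ms ℓ` with inclusions `jmap ℓ`)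
such that `inf(M^ℓ) → ∞` and for all `ℓ ≥ 1` the inclusions induce bijections
`Hom_{K(A)}(N, M^ℓ) ≅ Hom_{K(A)}(N, M)`. Then `Hom_{K(A)}(N, M) = 0`, i.e. every
DG homomorphism `N → M` is null-homotopic. -/
theorem homotopy_hom_vanish_of_htpy_iso_descending
    {R : Type} [CommRing R] {A : DGAlgebra R} (M N : DGModule R A)
    (hbb : BoundedBelow M) (hsf : IsSemifree N)
    (S : ℕ → DGSubmodule M) (hS0 : (S 0).toSubmodule = ⊤)
    (hdesc : ∀ ℓ : ℕ, (S (ℓ + 1)).toSubmodule ≤ (S ℓ).toSubmodule)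
    (Ms : ℕ → DGModule R A) (jmap : ∀ ℓ, DGHom (Ms ℓ) M)
    (hinj : ∀ ℓ, Function.Injective (jmap ℓ).toFun)
    (hrange : ∀ ℓ, Set.range (jmap ℓ).toFun = ((S ℓ).toSubmodule : Set M.carrier))
    (hinf : ∀ n : ℤ, ∃ L : ℕ, ∀ ℓ : ℕ, L ≤ ℓ → ∀ i : ℤ, i < n → (Ms ℓ).grading i = ⊥)
    (hiso : ∀ ℓ : ℕ, 1 ≤ ℓ → InducesHtpyBij N (jmap ℓ)) :
    ∀ f : DGHom N M, DGHomotopic f.toFun (fun _ => (0 : M.carrier)) := by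
  intro f
  choose g hg using fun l : ℕ => (hiso (l + 1) l.succ_pos).2 f
  have hfac : ∀ l, ∃ t : DGHom (Ms (l + 2)) (Ms (l + 1)),
      ∀ x, (jmap (l + 1)).toFun (t.toFun x) = (jmap (l + 2)).toFun x := fun l =>
    DGHom.exists_factor (hinj _) _ (by
      rw [hrange, hrange]
      exact hdesc (l + 1))
  choose t ht using hfac
  have hstep : ∀ l, DGHomotopic (g l).toFun ((t l).comp (g (l + 1))).toFun := fun l =>
    (hiso (l + 1) l.succ_pos).1 _ _ (by
      simp only [DGHom.comp, ht]
      exact (hg l).trans (hg (l + 1)).symm)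
  choose K hK using hstep
  have hinf' : ∀ n : ℤ, ∃ L : ℕ, ∀ l : ℕ, L ≤ l → ∀ i : ℤ, i < n →
      (Ms (l + 1)).grading i = ⊥ := fun n => by
    obtain ⟨L, hL⟩ := hinf n
    exact ⟨L, fun l hl => hL (l + 1) (by lia)⟩
  refine (hg 0).symm.trans (DGHomotopic.zero_of_telescope
    (fun l x => (jmap (l + 1)).toFun ((g l).toFun x))
    (fun l => GradedHom.postcomp (jmap (l + 1)) (K l)) (fun x => ?_) (fun x => ?_) fun l x => ?_)
  · obtain ⟨n, hn⟩ := GradedHom.eventually_eq_zero hinf' (fun l => (g l).toGradedHom) x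
    exact ⟨n, fun m hm => (congrArg _ (hn m hm)).trans (jmap (m + 1)).map_zero⟩
  · obtain ⟨n, hn⟩ := GradedHom.eventually_eq_zero hinf' K x
    exact ⟨n, fun m hm => (congrArg _ (hn m hm)).trans (jmap (m + 1)).map_zero⟩
  · have h := congrArg (jmap (l + 1)).toFun (hK l x)
    rw [DGHom.map_sub, DGHom.map_add, DGHom.comm_d] at h
    simp only [DGHom.comp, ht] at h
    exact h
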